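/- arXiv:2602.07851 — 4 statements merged into one kernel-verified Lean document; each statement's English description precedes it below -/
import Mathlib

section
/- A best approximation pair for 𝒜 and ℬ exists: there is (u_𝒜, u_ℬ) ∈ 𝒜 × ℬ with ‖u_𝒜 − u_ℬ‖ ≤ ‖x − y‖ for all (x, y) ∈ 𝒜 × ℬ. Moreover the gap vector is unique: if (u, u′) and (w, w′) are both best approximation pairs, then u − u′ = w − w′ in L²([0,1], ℝ). -/
open MeasureTheory

/-- The measure on ℝ representing integration over the interval [0,1]. -/
noncomputable def mu01 : Measure ℝ := volume.restrict (Set.Icc 0 1)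

/-- The affine set 𝒜 of controls in L²([0,1],ℝ) steering the double integrator
from (s₀, v₀) to (s_f, v_f). -/
def setA (s0 sf v0 vf : ℝ) : Set (Lp ℝ 2 mu01) :=
  {u | (∫ t, u t ∂mu01) = vf - v0 ∧ (∫ t, (1 - t) * u t ∂mu01) = sf - s0 - v0}

/-- The box ℬ of controls bounded in absolute value by `a` a.e. on [0,1]. -/
def setB (a : ℝ) : Set (Lp ℝ 2 mu01) :=
  {u | ∀ᵐ t ∂mu01, |u t| ≤ a}

open Filter Topology

section Hilbert

variable {E : Type*} [NormedAddCommGroup E] [InnerProductSpace ℝ E]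

/-- In a convex set, squared distance to a point of minimal norm is bounded by the excess of the
squared norm. -/
theorem Convex.norm_sub_sq_le_of_minimal_norm {K : Set E} (hK : Convex ℝ K) {v w : E}
    (hv : v ∈ K) (hw : w ∈ K) (hmin : ∀ x ∈ K, ‖v‖ ≤ ‖x‖) :
    ‖w - v‖ ^ 2 ≤ ‖w‖ ^ 2 - ‖v‖ ^ 2 := by
  have : Nonempty K := ⟨⟨v, hv⟩⟩
  have hinf : ‖(0 : E) - v‖ = ⨅ x : K, ‖(0 : E) - x‖ := by
    refine le_antisymm (le_ciInf fun x => by simpa using hmin x x.2) ?_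
    exact ciInf_le (f := fun x : K => ‖(0 : E) - x‖)
      ⟨0, by rintro _ ⟨x, rfl⟩; positivity⟩ ⟨v, hv⟩
  have h := (norm_eq_iInf_iff_real_inner_le_zero hK hv).1 hinf w hw
  rw [zero_sub, inner_neg_left, inner_sub_right, real_inner_self_eq_norm_sq] at h
  rw [norm_sub_sq_real, real_inner_comm]
  linarith

theorem Convex.eq_of_minimal_norm {K : Set E} (hK : Convex ℝ K) {v w : E}
    (hv : v ∈ K) (hw : w ∈ K) (hvmin : ∀ x ∈ K, ‖v‖ ≤ ‖x‖) (hwmin : ∀ x ∈ K, ‖w‖ ≤ ‖x‖) :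
    v = w := by
  have h := hK.norm_sub_sq_le_of_minimal_norm hv hw hvmin
  rw [le_antisymm (hwmin v hv) (hvmin w hw), sub_self] at h
  have h0 : ‖w - v‖ = 0 := pow_eq_zero_iff two_ne_zero |>.1 (le_antisymm h (sq_nonneg _))
  exact (sub_eq_zero.1 (norm_eq_zero.1 h0)).symm

variable [CompleteSpace E]

theorem exists_minimal_norm {K : Set E} (hne : K.Nonempty) (hc : IsClosed K)
    (hK : Convex ℝ K) : ∃ v ∈ K, ∀ x ∈ K, ‖v‖ ≤ ‖x‖ := by
  obtain ⟨v, hv, h⟩ := exists_norm_eq_iInf_of_complete_convex hne hc.isComplete hK 0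
  refine ⟨v, hv, fun x hx => ?_⟩
  have := ciInf_le (f := fun x : K => ‖(0 : E) - x‖)
    ⟨0, by rintro _ ⟨x, rfl⟩; positivity⟩ ⟨x, hx⟩
  rw [← h] at this
  simpa using this

/-- A decreasing sequence of nonempty bounded closed convex sets in a Hilbert space has a
common point. -/
theorem nonempty_iInter_of_antitone_of_convex {S : ℕ → Set E} (hanti : Antitone S)
    (hne : ∀ n, (S n).Nonempty) (hc : ∀ n, IsClosed (S n)) (hS : ∀ n, Convex ℝ (S n))
    (hb : Bornology.IsBounded (S 0)) : (⋂ n, S n).Nonempty := by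
  choose y hy hmin using fun n => exists_minimal_norm (hne n) (hc n) (hS n)
  have hmono : Monotone fun n => ‖y n‖ ^ 2 := fun m n hmn =>
    pow_le_pow_left₀ (norm_nonneg _) (hmin m _ (hanti hmn (hy n))) 2
  obtain ⟨C, hC⟩ := hb.exists_norm_le
  have hbdd : BddAbove (Set.range fun n => ‖y n‖ ^ 2) := by
    refine ⟨C ^ 2, ?_⟩
    rintro _ ⟨n, rfl⟩
    exact pow_le_pow_left₀ (norm_nonneg _) (hC _ (hanti (Nat.zero_le n) (hy n))) 2
  have hcauchy : CauchySeq y := by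
    have hsq := (tendsto_atTop_ciSup hmono hbdd).cauchySeq
    rw [Metric.cauchySeq_iff'] at hsq ⊢
    intro ε hε
    obtain ⟨N, hN⟩ := hsq (ε ^ 2) (by positivity)
    refine ⟨N, fun n hn => ?_⟩
    have h1 := (hS N).norm_sub_sq_le_of_minimal_norm (hy N) (hanti hn (hy n)) (hmin N)
    have h2 := (le_abs_self _).trans_lt (hN n hn)
    rw [dist_eq_norm]
    exact lt_of_pow_lt_pow_left₀ 2 hε.le (h1.trans_lt h2)
  obtain ⟨z, hz⟩ := cauchySeq_tendsto_of_complete hcauchy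
  refine ⟨z, Set.mem_iInter.2 fun n => (hc n).mem_of_tendsto hz ?_⟩
  filter_upwards [eventually_ge_atTop n] with m hm using hanti hm (hy m)

/-- Two nonempty closed convex sets in a Hilbert space, one of which is bounded, admit a best
approximation pair. -/
theorem exists_best_approximation_pair {A B : Set E} (hAne : A.Nonempty) (hAc : IsClosed A)
    (hA : Convex ℝ A) (hBne : B.Nonempty) (hBc : IsClosed B) (hB : Convex ℝ B)
    (hBb : Bornology.IsBounded B) :
    ∃ u ∈ A, ∃ v ∈ B, ∀ x ∈ A, ∀ y ∈ B, ‖u - v‖ ≤ ‖x - y‖ := by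
  have : Nonempty B := hBne.to_subtype
  have hbdd : BddBelow (Set.range fun y : B => Metric.infDist (y : E) A) :=
    ⟨0, by rintro _ ⟨y, rfl⟩; exact Metric.infDist_nonneg⟩
  set d := ⨅ y : B, Metric.infDist (y : E) A
  have hmem : ∀ (r : ℝ) (y : E), 0 ≤ r → (y ∈ Metric.cthickening r A ↔ Metric.infDist y A ≤ r) :=
    fun r y hr => by
      rw [Metric.mem_cthickening_iff, Metric.infDist,
        ENNReal.le_ofReal_iff_toReal_le (Metric.infEDist_ne_top hAne) hr]
  have hd0 : 0 ≤ d := le_ciInf fun y => Metric.infDist_nonneg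
  have hpos : ∀ n : ℕ, 0 < 1 / ((n : ℝ) + 1) := fun n => by positivity
  obtain ⟨v, hv⟩ := nonempty_iInter_of_antitone_of_convex
    (S := fun n : ℕ => B ∩ Metric.cthickening (d + 1 / ((n : ℝ) + 1)) A)
    (fun m n hmn => Set.inter_subset_inter_right _ <| Metric.cthickening_mono
      (by gcongr) _)
    (fun n => by
      obtain ⟨y, hy⟩ := exists_lt_of_ciInf_lt (show d < d + 1 / ((n : ℝ) + 1) by
        linarith [hpos n])
      exact ⟨y, y.2, (hmem _ _ (by linarith [hpos n])).2 hy.le⟩)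
    (fun n => hBc.inter Metric.isClosed_cthickening)
    (fun n => hB.inter (hA.cthickening _)) (hBb.subset Set.inter_subset_left)
  rw [Set.mem_iInter] at hv
  have hvd : Metric.infDist v A ≤ d := by
    have hlim : Tendsto (fun n : ℕ => d + 1 / ((n : ℝ) + 1)) atTop (𝓝 d) := by
      simpa using tendsto_one_div_add_atTop_nhds_zero_nat.const_add d
    exact ge_of_tendsto' hlim fun n => (hmem _ _ (by linarith [hpos n])).1 (hv n).2
  obtain ⟨u, hu, huv⟩ := exists_norm_eq_iInf_of_complete_convex hAne hAc.isComplete hA v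
  refine ⟨u, hu, v, (hv 0).1, fun x hx y hy => ?_⟩
  calc ‖u - v‖ = Metric.infDist v A := by
        rw [norm_sub_rev, huv, Metric.infDist_eq_iInf]
        simp only [dist_eq_norm]
    _ ≤ d := hvd
    _ ≤ Metric.infDist y A := ciInf_le hbdd ⟨y, hy⟩
    _ ≤ ‖x - y‖ := by
        rw [← dist_eq_norm, dist_comm]
        exact Metric.infDist_le_dist_of_mem hx

end Hilbert

instance : IsFiniteMeasure mu01 := by
  unfold mu01
  infer_instance

theorem memLp_mu01_of_continuous {f : ℝ → ℝ} (hf : Continuous f) : MemLp f 2 mu01 := by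
  obtain ⟨C, hC⟩ := isCompact_Icc.exists_bound_of_continuousOn (s := Set.Icc (0 : ℝ) 1)
    hf.continuousOn
  exact MemLp.of_bound hf.aestronglyMeasurable C
    (ae_restrict_of_forall_mem measurableSet_Icc hC)

theorem integral_mu01 (f : ℝ → ℝ) : ∫ t, f t ∂mu01 = ∫ t in (0 : ℝ)..1, f t := by
  rw [intervalIntegral.integral_of_le zero_le_one, mu01, integral_Icc_eq_integral_Ioc]

theorem inner_toLp_mu01 {f : ℝ → ℝ} (hf : MemLp f 2 mu01) (u : Lp ℝ 2 mu01) :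
    inner ℝ (hf.toLp f) u = ∫ t, f t * u t ∂mu01 := by
  rw [L2.inner_def]
  refine integral_congr_ae ?_
  filter_upwards [hf.coeFn_toLp] with t ht
  rw [ht, real_inner_eq_re_inner, RCLike.inner_apply]
  simp [mul_comm]

theorem setA_eq_inter (s0 sf v0 vf : ℝ) : ∃ e₁ e₂ : Lp ℝ 2 mu01, setA s0 sf v0 vf =
    {u | inner ℝ e₁ u = vf - v0} ∩ {u | inner ℝ e₂ u = sf - s0 - v0} := by
  refine ⟨(memLp_mu01_of_continuous (f := fun _ => 1) (by fun_prop)).toLp _,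
    (memLp_mu01_of_continuous (f := fun t => 1 - t) (by fun_prop)).toLp _, ?_⟩
  ext u
  simp only [setA, Set.mem_inter_iff, Set.mem_ofPred_eq, inner_toLp_mu01, one_mul]

theorem isClosed_setA (s0 sf v0 vf : ℝ) : IsClosed (setA s0 sf v0 vf) := by
  obtain ⟨e₁, e₂, h⟩ := setA_eq_inter s0 sf v0 vf
  rw [h]
  exact (isClosed_eq (by fun_prop) continuous_const).inter
    (isClosed_eq (by fun_prop) continuous_const)

theorem convex_setA (s0 sf v0 vf : ℝ) : Convex ℝ (setA s0 sf v0 vf) := by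
  obtain ⟨e₁, e₂, h⟩ := setA_eq_inter s0 sf v0 vf
  rw [h]
  exact (convex_hyperplane (innerSL ℝ e₁).isLinear _).inter
    (convex_hyperplane (innerSL ℝ e₂).isLinear _)

/-- The endpoint constraints can be met by a control that is affine in time. -/
theorem setA_nonempty (s0 sf v0 vf : ℝ) : (setA s0 sf v0 vf).Nonempty := by
  set α := vf - v0
  set β := sf - s0 - v0
  have hf := memLp_mu01_of_continuous (f := fun t => 6 * β - 2 * α + (6 * α - 12 * β) * t)
    (by fun_prop)
  refine ⟨hf.toLp _, ?_, ?_⟩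
  · rw [integral_congr_ae hf.coeFn_toLp, integral_mu01,
      intervalIntegral.integral_add (by simp) (Continuous.intervalIntegrable (by fun_prop) _ _),
      intervalIntegral.integral_const_mul, integral_id, intervalIntegral.integral_const]
    simp only [smul_eq_mul]
    ring
  · have h : ∫ t, (1 - t) * hf.toLp _ t ∂mu01 =
        ∫ t, ((6 * β - 2 * α) + (8 * α - 18 * β) * t) + (12 * β - 6 * α) * t ^ 2 ∂mu01 := by
      refine integral_congr_ae ?_
      filter_upwards [hf.coeFn_toLp] with t ht
      rw [ht]
      ring
    rw [h, integral_mu01,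
      intervalIntegral.integral_add (Continuous.intervalIntegrable (by fun_prop) _ _)
        (Continuous.intervalIntegrable (by fun_prop) _ _),
      intervalIntegral.integral_add (by simp) (Continuous.intervalIntegrable (by fun_prop) _ _),
      intervalIntegral.integral_const_mul, intervalIntegral.integral_const_mul, integral_id,
      integral_pow, intervalIntegral.integral_const]
    simp only [smul_eq_mul]
    norm_num
    ring

theorem setB_eq_Icc (a : ℝ) : setB a = Set.Icc
    (-(memLp_const a : MemLp (fun _ : ℝ => a) 2 mu01).toLp _)
    ((memLp_const a : MemLp (fun _ : ℝ => a) 2 mu01).toLp _) := by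
  have hc := (memLp_const a : MemLp (fun _ : ℝ => a) 2 mu01).coeFn_toLp
  have hn := Lp.coeFn_neg ((memLp_const a : MemLp (fun _ : ℝ => a) 2 mu01).toLp _)
  ext u
  rw [setB, Set.mem_ofPred_eq, Set.mem_Icc, ← Lp.coeFn_le, ← Lp.coeFn_le, EventuallyLE, EventuallyLE,
    ← eventually_and]
  refine eventually_congr ?_
  filter_upwards [hc, hn] with t h1 h2
  rw [h2, Pi.neg_apply, h1, abs_le]

theorem isClosed_setB (a : ℝ) : IsClosed (setB a) := by
  rw [setB_eq_Icc]
  exact isClosed_Icc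

theorem convex_setB (a : ℝ) : Convex ℝ (setB a) := by
  intro u hu v hv c d hc hd hcd
  filter_upwards [hu, hv, Lp.coeFn_add (c • u) (d • v), Lp.coeFn_smul c u, Lp.coeFn_smul d v]
    with t h1 h2 h3 h4 h5
  rw [h3, Pi.add_apply, h4, h5, Pi.smul_apply, Pi.smul_apply]
  rw [← Real.norm_eq_abs, ← mem_closedBall_zero_iff] at *
  exact convex_closedBall (0 : ℝ) a h1 h2 hc hd hcd

theorem setB_nonempty {a : ℝ} (ha : 0 ≤ a) : (setB a).Nonempty := by
  refine ⟨0, ?_⟩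
  filter_upwards [Lp.coeFn_zero ℝ 2 mu01] with t ht
  rwa [ht, Pi.zero_apply, abs_zero]

theorem isBounded_setB {a : ℝ} (ha : 0 ≤ a) : Bornology.IsBounded (setB a) :=
  isBounded_iff_forall_norm_le.2 ⟨_, fun _ hu => Lp.norm_le_of_ae_bound ha hu⟩

/-- A best approximation pair for 𝒜 and ℬ exists, and the gap vector is unique. -/
theorem stmt_2 (s0 sf v0 vf a : ℝ) (ha : 0 < a) :
    (∃ uA ∈ setA s0 sf v0 vf, ∃ uB ∈ setB a,
      ∀ x ∈ setA s0 sf v0 vf, ∀ y ∈ setB a, ‖uA - uB‖ ≤ ‖x - y‖) ∧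
    (∀ u ∈ setA s0 sf v0 vf, ∀ u' ∈ setB a, ∀ w ∈ setA s0 sf v0 vf, ∀ w' ∈ setB a,
      (∀ x ∈ setA s0 sf v0 vf, ∀ y ∈ setB a, ‖u - u'‖ ≤ ‖x - y‖) →
      (∀ x ∈ setA s0 sf v0 vf, ∀ y ∈ setB a, ‖w - w'‖ ≤ ‖x - y‖) →
      u - u' = w - w') := by
  refine ⟨exists_best_approximation_pair (setA_nonempty s0 sf v0 vf) (isClosed_setA s0 sf v0 vf)
    (convex_setA s0 sf v0 vf) (setB_nonempty ha.le) (isClosed_setB a) (convex_setB a)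
    (isBounded_setB ha.le), ?_⟩
  intro u hu u' hu' w hw w' hw' hmin hmin'
  refine ((convex_setA s0 sf v0 vf).sub (convex_setB a)).eq_of_minimal_norm
    (Set.sub_mem_sub hu hu') (Set.sub_mem_sub hw hw') ?_ ?_
  · rintro _ ⟨x, hx, y, hy, rfl⟩
    exact hmin x hx y hy
  · rintro _ ⟨x, hx, y, hy, rfl⟩
    exact hmin' x hx y hy
end

section
/- Suppose v₀ ≠ v_f and s_f − s₀ ≠ (v₀ + v_f)/2. Then there exists t_c ∈ (0,1) with 2·t_c ≠ 1 satisfying the quadratic equation (v_f − v₀)·t_c² + 2·(s_f − s₀ − v_f)·t_c + (v₀ + v_f)/2 − (s_f − s₀) = 0 such that, for every a > 0, the intersection 𝒜 ∩ ℬ is nonempty if and only if a ≥ |v_f − v₀| / |2·t_c − 1|. That is, the critical feasibility bound is a_c = |v_f − v₀| / |2·t_c − 1|. -/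
open MeasureTheory

instance inst_s4 : IsFiniteMeasure mu01 := by
  unfold mu01
  infer_instance

lemma Continuous.integrable_mu01 {p : ℝ → ℝ} (hp : Continuous p) : Integrable p mu01 :=
  hp.continuousOn.integrableOn_compact isCompact_Icc

/-- Integration over `[0, 1]` of a function with one switching time `c`. -/
lemma integral_mu01_ite {c : ℝ} (hc : c ∈ Set.Ioo (0 : ℝ) 1) {p q : ℝ → ℝ}
    (hp : Continuous p) (hq : Continuous q) :
    ∫ t, (if t ≤ c then p t else q t) ∂mu01 = (∫ t in (0 : ℝ)..c, p t) + ∫ t in c..1, q t := by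
  have h_int : Integrable (fun t => if t ≤ c then p t else q t) mu01 :=
    Integrable.piecewise (s := Set.Iic c) measurableSet_Iic
      hp.integrable_mu01.integrableOn hq.integrable_mu01.integrableOn
  have hI : IntegrableOn (fun t => if t ≤ c then p t else q t) (Set.Icc 0 1) := h_int
  have h0 : IntervalIntegrable (fun t => if t ≤ c then p t else q t) volume 0 c :=
    (intervalIntegrable_iff_integrableOn_Icc_of_le hc.1.le).2
      (hI.mono_set (Set.Icc_subset_Icc le_rfl hc.2.le))
  have h1 : IntervalIntegrable (fun t => if t ≤ c then p t else q t) volume c 1 :=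
    (intervalIntegrable_iff_integrableOn_Icc_of_le hc.2.le).2
      (hI.mono_set (Set.Icc_subset_Icc hc.1.le le_rfl))
  rw [mu01, integral_Icc_eq_integral_Ioc, ← intervalIntegral.integral_of_le zero_le_one,
    ← intervalIntegral.integral_add_adjacent_intervals h0 h1]
  congr 1
  · refine intervalIntegral.integral_congr_ae (Filter.Eventually.of_forall fun t ht => ?_)
    rw [Set.uIoc_of_le hc.1.le] at ht
    exact if_pos ht.2
  · refine intervalIntegral.integral_congr_ae (Filter.Eventually.of_forall fun t ht => ?_)
    rw [Set.uIoc_of_le hc.2.le] at ht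
    exact if_neg (not_le.2 ht.1)

lemma integral_affine (a b k m : ℝ) :
    ∫ t in a..b, (k + m * t) = k * (b - a) + m * ((b ^ 2 - a ^ 2) / 2) := by
  rw [intervalIntegral.integral_add (by simp) (Continuous.intervalIntegrable (by fun_prop) _ _),
    intervalIntegral.integral_const, intervalIntegral.integral_const_mul, integral_id,
    smul_eq_mul, mul_comm k]

lemma integral_mu01_ite_affine {c : ℝ} (hc : c ∈ Set.Ioo (0 : ℝ) 1) (k m k' m' : ℝ) :
    ∫ t, (if t ≤ c then k + m * t else k' + m' * t) ∂mu01 =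
      k * c + m * (c ^ 2 / 2) + (k' * (1 - c) + m' * ((1 - c ^ 2) / 2)) := by
  rw [integral_mu01_ite hc (by fun_prop) (by fun_prop), integral_affine, integral_affine]
  ring

/-- A bang-bang control with switching time `c` and values `K`, `-K`. -/
lemma exists_bangBang {c : ℝ} (hc : c ∈ Set.Ioo (0 : ℝ) 1) (K : ℝ) :
    ∃ u : Lp ℝ 2 mu01, (∫ t, u t ∂mu01) = K * (2 * c - 1) ∧
      (∫ t, (1 - t) * u t ∂mu01) = K * (2 * c - c ^ 2 - 1 / 2) ∧ ∀ᵐ t ∂mu01, |u t| = |K| := by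
  have hmeas : Measurable fun t : ℝ => if t ≤ c then K else -K :=
    Measurable.ite measurableSet_Iic measurable_const measurable_const
  have habs (t : ℝ) : |if t ≤ c then K else -K| = |K| := by split_ifs <;> simp
  have hLp : MemLp (fun t : ℝ => if t ≤ c then K else -K) 2 mu01 :=
    MemLp.of_bound hmeas.aestronglyMeasurable |K|
      (Filter.Eventually.of_forall fun t => (habs t).le)
  have hu := hLp.coeFn_toLp
  refine ⟨hLp.toLp _, ?_, ?_, ?_⟩
  · rw [integral_congr_ae hu]
    have h := integral_mu01_ite_affine hc K 0 (-K) 0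
    simp only [zero_mul, add_zero] at h
    rw [h]
    ring
  · have h := integral_mu01_ite_affine hc K (-K) (-K) K
    rw [integral_congr_ae (g := fun t => if t ≤ c then K + -K * t else -K + K * t), h]
    · ring
    · filter_upwards [hu] with t ht
      rw [ht]
      split_ifs <;> ring
  · filter_upwards [hu] with t ht
    rw [ht, habs]

/-- The sharp bound on the moment of order one about `c` of a control bounded by `a`. -/
lemma abs_moment_le {c : ℝ} (hc : c ∈ Set.Ioo (0 : ℝ) 1) {a : ℝ} {u : Lp ℝ 2 mu01}
    (hu : ∀ᵐ t ∂mu01, |u t| ≤ a) :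
    |(∫ t, (1 - t) * u t ∂mu01) - (1 - c) * ∫ t, u t ∂mu01| ≤
      a * ((c ^ 2 + (1 - c) ^ 2) / 2) := by
  have h_int : Integrable u mu01 := (Lp.memLp u).integrable (by norm_num)
  have h_int' : Integrable (fun t => (1 - t) * u t) mu01 := by
    have h : Continuous fun t : ℝ => 1 - t := by fun_prop
    refine (h.integrable_mu01.mul_const a).mono
      (h.aestronglyMeasurable.mul h_int.aestronglyMeasurable) ?_
    filter_upwards [hu] with t ht
    rw [norm_mul, norm_mul]
    exact mul_le_mul_of_nonneg_left (ht.trans (le_abs_self a)) (norm_nonneg _)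
  have habs : ∫ t, a * |c - t| ∂mu01 = a * ((c ^ 2 + (1 - c) ^ 2) / 2) := by
    have h := integral_mu01_ite_affine hc c (-1) (-c) 1
    rw [integral_const_mul,
      integral_congr_ae (g := fun t => if t ≤ c then c + -1 * t else -c + 1 * t), h]
    · ring
    · refine Filter.Eventually.of_forall fun t => ?_
      change |c - t| = if t ≤ c then c + -1 * t else -c + 1 * t
      split_ifs with ht
      · rw [abs_of_nonneg (by linarith)]
        ring
      · rw [abs_of_neg (by linarith)]
        ring
  have hmaj : Continuous fun t => a * |c - t| := by fun_prop
  rw [← integral_const_mul, ← integral_sub h_int' (h_int.const_mul _), ← habs]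
  refine (Real.norm_eq_abs _).ge.trans (norm_integral_le_of_norm_le hmaj.integrable_mu01 ?_)
  filter_upwards [hu] with t ht
  rw [show (1 - t) * u t - (1 - c) * u t = u t * (c - t) by ring, norm_mul]
  exact mul_le_mul_of_nonneg_right ht (abs_nonneg _)

/-- A quadratic taking opposite nonzero values at `0` and `1` has a root in `(0, 1)`. -/
lemma exists_root_Ioo (d : ℝ) {e : ℝ} (he : e ≠ 0) :
    ∃ c ∈ Set.Ioo (0 : ℝ) 1, d * c ^ 2 + (2 * e - d) * c - e = 0 := by
  have hcont : ContinuousOn (fun c : ℝ => d * c ^ 2 + (2 * e - d) * c - e) (Set.Icc 0 1) := by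
    fun_prop
  rcases he.lt_or_gt with h | h
  · exact intermediate_value_Ioo' zero_le_one hcont ⟨by norm_num; linarith, by norm_num; linarith⟩
  · exact intermediate_value_Ioo zero_le_one hcont ⟨by norm_num; linarith, by norm_num; linarith⟩

/-- Critical feasibility bound, case s_f - s₀ ≠ (v₀+v_f)/2 and v₀ ≠ v_f:
a_c = |v_f - v₀| / |2 t_c - 1| where t_c solves the stated quadratic. -/
theorem stmt_4 (s0 sf v0 vf : ℝ) (hv : v0 ≠ vf)
    (hs : sf - s0 ≠ (v0 + vf) / 2) :
    ∃ tc : ℝ, tc ∈ Set.Ioo (0 : ℝ) 1 ∧ 2 * tc ≠ 1 ∧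
      (vf - v0) * tc ^ 2 + 2 * (sf - s0 - vf) * tc + (v0 + vf) / 2 - (sf - s0) = 0 ∧
      ∀ a : ℝ, 0 < a →
        ((setA s0 sf v0 vf ∩ setB a).Nonempty ↔ |vf - v0| / |2 * tc - 1| ≤ a) := by
  obtain ⟨c, hc, hq⟩ := exists_root_Ioo (vf - v0) (sub_ne_zero.2 hs)
  have hc2 : 2 * c - 1 ≠ 0 := by
    intro h
    obtain rfl : c = 1 / 2 := by linarith
    exact hv (by linarith)
  refine ⟨c, hc, sub_ne_zero.1 hc2, by linarith, fun a _ => ?_⟩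
  rw [← abs_div]
  obtain ⟨K, hK⟩ : ∃ K, K = (vf - v0) / (2 * c - 1) := ⟨_, rfl⟩
  have hKd : K * (2 * c - 1) = vf - v0 := by rw [hK, div_mul_cancel₀ _ hc2]
  have hKw : K * (2 * c - c ^ 2 - 1 / 2) = sf - s0 - v0 := by
    apply mul_right_cancel₀ hc2
    linear_combination (2 * c - c ^ 2 - 1 / 2) * hKd - hq
  rw [← hK]
  constructor
  · rintro ⟨u, ⟨hu0, hu1⟩, hua⟩
    have h := abs_moment_le hc hua
    have hpos : 0 < (c ^ 2 + (1 - c) ^ 2) / 2 := by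
      nlinarith [sq_pos_of_pos hc.1, sq_nonneg (1 - c)]
    rw [hu0, hu1, ← hKd, ← hKw, show K * (2 * c - c ^ 2 - 1 / 2) - (1 - c) * (K * (2 * c - 1)) =
      K * ((c ^ 2 + (1 - c) ^ 2) / 2) by ring, abs_mul, abs_of_pos hpos] at h
    exact le_of_mul_le_mul_right h hpos
  · intro ha
    obtain ⟨u, hu0, hu1, hua⟩ := exists_bangBang hc K
    exact ⟨u, ⟨hu0.trans hKd, hu1.trans hKw⟩, hua.mono fun t ht => ht.le.trans ha⟩
end

section
/- Suppose v₀ = v_f. Then for every a > 0, the intersection 𝒜 ∩ ℬ is nonempty if and only if a ≥ 4·|v_f + s₀ − s_f|. That is, the critical feasibility bound is a_c = 4·|v_f + s₀ − s_f|. -/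
open MeasureTheory

lemma isFiniteMeasure_mu01 : IsFiniteMeasure mu01 := by
  unfold mu01; infer_instance

/-- The bang-bang control equal to `-k` up to time `1/2` and to `k` afterwards. -/
noncomputable def bangBang (k : ℝ) (t : ℝ) : ℝ := if t ≤ 1 / 2 then -k else k

lemma measurable_bangBang (k : ℝ) : Measurable (bangBang k) :=
  Measurable.ite measurableSet_Iic measurable_const measurable_const

lemma abs_bangBang (k t : ℝ) : |bangBang k t| = |k| := by
  unfold bangBang; split_ifs <;> simp

lemma integral_mul_bangBang {g : ℝ → ℝ} (hg : Continuous g) (k : ℝ) :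
    ∫ t, g t * bangBang k t ∂mu01 =
      k * ((∫ t in (1 / 2 : ℝ)..1, g t) - ∫ t in (0 : ℝ)..(1 / 2), g t) := by
  have int : ∀ a b : ℝ, IntervalIntegrable (fun t => g t * bangBang k t) volume a b := by
    intro a b
    refine IntervalIntegrable.continuousOn_mul ?_ hg.continuousOn
    refine (intervalIntegrable_const (c := k)).mono_fun
      (measurable_bangBang k).aestronglyMeasurable (Filter.Eventually.of_forall fun t => ?_)
    simp [abs_bangBang]
  have left : ∫ t in (0 : ℝ)..(1 / 2), g t * bangBang k t =
      ∫ t in (0 : ℝ)..(1 / 2), g t * (-k) := by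
    refine intervalIntegral.integral_congr fun t ht => ?_
    rw [Set.uIcc_of_le (by norm_num)] at ht
    simp only [bangBang, if_pos ht.2]
  have right : ∫ t in (1 / 2 : ℝ)..1, g t * bangBang k t =
      ∫ t in (1 / 2 : ℝ)..1, g t * k := by
    refine intervalIntegral.integral_congr_ae (Filter.Eventually.of_forall fun t ht => ?_)
    rw [Set.uIoc_of_le (by norm_num)] at ht
    simp only [bangBang, if_neg (not_le.mpr ht.1)]
  rw [mu01, integral_Icc_eq_integral_Ioc, ← intervalIntegral.integral_of_le zero_le_one,
    ← intervalIntegral.integral_add_adjacent_intervals (int 0 (1 / 2)) (int (1 / 2) 1),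
    left, right, intervalIntegral.integral_mul_const, intervalIntegral.integral_mul_const]
  ring

lemma integral_bangBang (k : ℝ) : ∫ t, bangBang k t ∂mu01 = 0 := by
  have h := integral_mul_bangBang (g := fun _ => 1) continuous_const k
  simp only [one_mul, intervalIntegral.integral_const, smul_eq_mul] at h
  rw [h]; norm_num

lemma integral_one_sub_mul_bangBang (k : ℝ) :
    ∫ t, (1 - t) * bangBang k t ∂mu01 = -(k / 4) := by
  rw [integral_mul_bangBang (g := fun t => 1 - t) (by fun_prop)]
  simp only [intervalIntegral.integral_sub intervalIntegrable_const
    intervalIntegral.intervalIntegrable_id, intervalIntegral.integral_const, integral_id]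
  norm_num
  ring

lemma integral_abs_sub_half : ∫ t, |t - 1 / 2| ∂mu01 = 1 / 4 := by
  have h : ∀ t : ℝ, |t - 1 / 2| = (t - 1 / 2) * bangBang 1 t := by
    intro t
    unfold bangBang
    split_ifs with ht
    · rw [abs_of_nonpos (by linarith)]; ring
    · rw [abs_of_pos (by linarith)]; ring
  simp only [h]
  rw [integral_mul_bangBang (g := fun t => t - 1 / 2) (by fun_prop)]
  simp only [intervalIntegral.integral_sub intervalIntegral.intervalIntegrable_id
    intervalIntegrable_const, intervalIntegral.integral_const, integral_id]
  norm_num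

lemma integrable_mu01_of_continuous {g : ℝ → ℝ} (hg : Continuous g) : Integrable g mu01 :=
  hg.continuousOn.integrableOn_Icc

/-- Critical feasibility bound, case v₀ = v_f: a_c = 4·|v_f + s₀ - s_f|. -/
theorem stmt_5 (s0 sf v0 vf : ℝ) (hv : v0 = vf) :
    ∀ a : ℝ, 0 < a →
      ((setA s0 sf v0 vf ∩ setB a).Nonempty ↔ 4 * |vf + s0 - sf| ≤ a) := by
  intro a ha
  subst hv
  have := isFiniteMeasure_mu01
  constructor
  · rintro ⟨u, ⟨hu₀, hu₁⟩, hB⟩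
    have hB : ∀ᵐ t ∂mu01, |u t| ≤ a := hB
    have hu : Integrable u mu01 := (Lp.memLp u).integrable (by norm_num)
    have hmul : Integrable (fun t => (1 - t) * u t) mu01 :=
      (integrable_mu01_of_continuous (g := fun t => 1 - t) (by fun_prop)).mul_bdd
        (c := a) hu.aestronglyMeasurable hB
    have key : ∫ t, (t - 1 / 2) * u t ∂mu01 = v0 + s0 - sf := by
      have h : ∀ t, (t - 1 / 2) * u t = 1 / 2 * u t - (1 - t) * u t := fun t => by ring
      simp only [h]
      rw [integral_sub (hu.const_mul _) hmul, integral_const_mul, hu₀, hu₁]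
      ring
    have bound : |∫ t, (t - 1 / 2) * u t ∂mu01| ≤ ∫ t, |t - 1 / 2| * a ∂mu01 := by
      rw [← Real.norm_eq_abs]
      refine norm_integral_le_of_norm_le (g := fun t => |t - 1 / 2| * a)
        (integrable_mu01_of_continuous (by fun_prop)) ?_
      filter_upwards [hB] with t ht
      rw [Real.norm_eq_abs, abs_mul]
      gcongr
    rw [key, integral_mul_const, integral_abs_sub_half] at bound
    linarith
  · intro h
    set k := 4 * (v0 + s0 - sf) with hk
    have hmem : MemLp (bangBang k) 2 mu01 :=
      MemLp.of_bound (measurable_bangBang k).aestronglyMeasurable |k|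
        (Filter.Eventually.of_forall fun t => (abs_bangBang k t).le)
    have hae := hmem.coeFn_toLp
    refine ⟨hmem.toLp (bangBang k), ⟨?_, ?_⟩, ?_⟩
    · rw [integral_congr_ae hae, integral_bangBang, sub_self]
    · have hae' : (fun t => (1 - t) * hmem.toLp (bangBang k) t) =ᵐ[mu01]
          fun t => (1 - t) * bangBang k t := by
        filter_upwards [hae] with t ht
        rw [ht]
      rw [integral_congr_ae hae', integral_one_sub_mul_bangBang]
      linarith
    · change ∀ᵐ t ∂mu01, |hmem.toLp (bangBang k) t| ≤ a
      filter_upwards [hae] with t ht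
      rw [ht, abs_bangBang, hk, abs_mul, abs_of_pos (by norm_num : (0 : ℝ) < 4)]
      exact h
end

section
/- Let a > 0 and let c₂ be a nonzero real number, and set r := sgn(c₂)·a. If the constant function with value r + c₂ belongs to 𝒜, then s_f − s₀ = (v₀ + v_f)/2, c₂ = v_f − v₀ − r, and a < |v_f − v₀| (so in particular v₀ ≠ v_f). -/
open MeasureTheory

/-- If the constant function with value r + c₂, r = sgn(c₂)·a, belongs to 𝒜, then
s_f - s₀ = (v₀ + v_f)/2, c₂ = v_f - v₀ - r, and a < |v_f - v₀|. -/
theorem stmt_14 (s0 sf v0 vf a c2 : ℝ) (ha : 0 < a) (hc2 : c2 ≠ 0)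
    (u : Lp ℝ 2 mu01)
    (hu : ∀ᵐ t ∂mu01, u t = Real.sign c2 * a + c2)
    (hmem : u ∈ setA s0 sf v0 vf) :
    sf - s0 = (v0 + vf) / 2 ∧ c2 = vf - v0 - Real.sign c2 * a ∧
      a < |vf - v0| ∧ v0 ≠ vf := by
  obtain ⟨h1, h2⟩ := hmem
  have e1 : (∫ t, u t ∂mu01) = Real.sign c2 * a + c2 := by
    rw [integral_congr_ae hu]
    simp [mu01]
  have e2 : (∫ t, (1 - t) * u t ∂mu01) = (Real.sign c2 * a + c2) / 2 := by
    have h : ∀ᵐ t ∂mu01, (1 - t) * u t = (1 - t) * (Real.sign c2 * a + c2) := by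
      filter_upwards [hu] with t ht
      rw [ht]
    rw [integral_congr_ae h, integral_mul_const, mu01, integral_Icc_eq_integral_Ioc,
      ← intervalIntegral.integral_of_le zero_le_one,
      intervalIntegral.integral_sub (by simp) (by simp)]
    simp only [intervalIntegral.integral_const, integral_id, smul_eq_mul]
    ring
  rw [e1] at h1
  rw [e2] at h2
  have habs : a < |vf - v0| := by
    rw [← h1]
    rcases lt_or_gt_of_ne hc2 with h | h
    · rw [Real.sign_of_neg h, lt_abs]
      right
      linarith
    · rw [Real.sign_of_pos h, lt_abs]
      left
      linarith
  refine ⟨by linarith, by linarith, habs, ?_⟩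
  rintro rfl
  rw [sub_self, abs_zero] at habs
  linarith
end
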